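/- Let A and B be separable unital C*-algebras and let α : A → B be a surjective unital *-homomorphism. If A is compact (i.e. Σ(A) is a compact subset of (Rep(A), d_K) for a compact generating set K of A), then B is compact (i.e. Σ(B) is a compact subset of (Rep(B), d_{K'}) for a compact generating set K' of B). -/

import Mathlib

noncomputable section

abbrev H2 : Type := lp (fun _ : ℕ => ℂ) 2
abbrev BH : Type := H2 →L[ℂ] H2

abbrev RepSp (A : Type*) [CStarAlgebra A] := A →⋆ₐ[ℂ] BH

def Generates {A : Type*} [CStarAlgebra A] (K : Set A) : Prop :=
  (StarAlgebra.adjoin ℂ K).topologicalClosure = ⊤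

def dRep {A : Type*} [CStarAlgebra A] (K : Set A) (π₁ π₂ : RepSp A) : ℝ :=
  ⨆ a ∈ K, ‖π₁ a - π₂ a‖

abbrev lpE (n : ℕ) : Type := lp (fun _ : ℕ => EuclideanSpace ℂ (Fin n)) 2

/-- A representation is irreducible if its commutant is trivial. -/
def IsIrredRep {A : Type*} [CStarAlgebra A] (π : RepSp A) : Prop :=
  ∀ T : BH, (∀ a : A, T * π a = π a * T) → ∃ c : ℂ, T = c • (1 : BH)

/-- `Σ⁰(A)`: irreducible representations on `ℓ²`, together with the countable
amplifications `ℵ₀ ⊙ ρ` of finite-dimensional irreducible representations `ρ`. -/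
def Sigma0 (A : Type*) [CStarAlgebra A] : Set (RepSp A) :=
  {π | IsIrredRep π ∨
    ∃ n : ℕ, 0 < n ∧ ∃ ρ : A →⋆ₐ[ℂ] Matrix (Fin n) (Fin n) ℂ,
      (∀ T : Matrix (Fin n) (Fin n) ℂ, (∀ a : A, T * ρ a = ρ a * T) →
        ∃ c : ℂ, T = c • (1 : Matrix (Fin n) (Fin n) ℂ)) ∧
      ∃ u : H2 ≃ₗᵢ[ℂ] lpE n, ∀ (a : A) (f : lpE n) (k : ℕ),
        u (π a (u.symm f)) k = Matrix.toEuclideanLin (ρ a) (f k)}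

/-- `Σ(A)`: the closure of `Σ⁰(A)` with respect to the metric `d_K`. -/
def SigmaSet {A : Type*} [CStarAlgebra A] (K : Set A) : Set (RepSp A) :=
  {π | ∀ ε > (0 : ℝ), ∃ π' ∈ Sigma0 A, dRep K π π' < ε}

/-- Sequential compactness of a set of representations with respect to `d_K`;
for the metric space `(Rep(A), d_K)` this is equivalent to compactness. -/
def RepSeqCompact {A : Type*} [CStarAlgebra A] (K : Set A) (S : Set (RepSp A)) : Prop :=
  ∀ u : ℕ → RepSp A, (∀ n, u n ∈ S) →
    ∃ π ∈ S, ∃ φ : ℕ → ℕ, StrictMono φ ∧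
      Filter.Tendsto (fun n => dRep K (u (φ n)) π) Filter.atTop (nhds 0)

section RepMetric

variable {A : Type*} [CStarAlgebra A] {K : Set A}

theorem dRep_nonneg (K : Set A) (π₁ π₂ : RepSp A) : 0 ≤ dRep K π₁ π₂ :=
  Real.iSup_nonneg fun _ => Real.iSup_nonneg fun _ => norm_nonneg _

theorem dRep_le {π₁ π₂ : RepSp A} {c : ℝ} (hc : 0 ≤ c) (h : ∀ a ∈ K, ‖π₁ a - π₂ a‖ ≤ c) :
    dRep K π₁ π₂ ≤ c :=
  Real.iSup_le (fun a => Real.iSup_le (h a) hc) hc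

theorem RepSp.norm_apply_le (π : RepSp A) (a : A) : ‖π a‖ ≤ ‖a‖ :=
  NonUnitalStarAlgHom.norm_apply_le π a

theorem norm_sub_le_dRep (hK : IsCompact K) (π₁ π₂ : RepSp A) {a : A} (ha : a ∈ K) :
    ‖π₁ a - π₂ a‖ ≤ dRep K π₁ π₂ := by
  obtain ⟨C, hC⟩ := hK.isBounded.exists_norm_le
  have hbdd : BddAbove (Set.range fun a => ⨆ _ : a ∈ K, ‖π₁ a - π₂ a‖) := by
    refine ⟨C + C, ?_⟩
    rintro _ ⟨b, rfl⟩
    have hC0 : 0 ≤ C := (norm_nonneg a).trans (hC a ha)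
    refine Real.iSup_le (fun hb => ?_) (by positivity)
    exact (norm_sub_le _ _).trans (add_le_add ((π₁.norm_apply_le b).trans (hC b hb))
      ((π₂.norm_apply_le b).trans (hC b hb)))
  exact (ciSup_pos (f := fun _ : a ∈ K => ‖π₁ a - π₂ a‖) ha).ge.trans (le_ciSup hbdd a)

theorem dRep_comm (K : Set A) (π₁ π₂ : RepSp A) : dRep K π₁ π₂ = dRep K π₂ π₁ := by
  simp only [dRep, norm_sub_rev]

theorem dRep_triangle (hK : IsCompact K) (π₁ π₂ π₃ : RepSp A) :
    dRep K π₁ π₃ ≤ dRep K π₁ π₂ + dRep K π₂ π₃ := by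
  refine dRep_le (add_nonneg (dRep_nonneg _ _ _) (dRep_nonneg _ _ _)) fun a ha => ?_
  exact (norm_sub_le_norm_sub_add_norm_sub _ (π₂ a) _).trans
    (add_le_add (norm_sub_le_dRep hK π₁ π₂ ha) (norm_sub_le_dRep hK π₂ π₃ ha))

/-- Convergence in the metric `d_K` of a compact generating set implies pointwise convergence. -/
theorem tendsto_apply_of_tendsto_dRep (hK : IsCompact K) (hgen : Generates K)
    {u : ℕ → RepSp A} {π : RepSp A}
    (h : Filter.Tendsto (fun n => dRep K (u n) π) Filter.atTop (nhds 0)) (a : A) :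
    Filter.Tendsto (fun n => u n a) Filter.atTop (nhds (π a)) := by
  have hadj : ∀ x ∈ StarAlgebra.adjoin ℂ K,
      Filter.Tendsto (fun n => u n x) Filter.atTop (nhds (π x)) := by
    intro x hx
    induction hx using StarAlgebra.adjoin_induction with
    | mem x hx =>
      rw [tendsto_iff_norm_sub_tendsto_zero]
      exact squeeze_zero (fun _ => norm_nonneg _) (fun n => norm_sub_le_dRep hK (u n) π hx) h
    | algebraMap r => simp only [AlgHomClass.commutes]; exact tendsto_const_nhds
    | add x y _ _ hx hy => simpa only [map_add] using hx.add hy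
    | mul x y _ _ hx hy => simpa only [map_mul] using hx.mul hy
    | star x _ hx => simpa only [map_star] using hx.star
  have ha : a ∈ closure (StarAlgebra.adjoin ℂ K : Set A) := by
    rw [← StarSubalgebra.topologicalClosure_coe, hgen]
    trivial
  rw [Metric.tendsto_atTop]
  intro ε hε
  obtain ⟨x, hx, hax⟩ := Metric.mem_closure_iff.1 ha (ε / 3) (by positivity)
  obtain ⟨N, hN⟩ := Metric.tendsto_atTop.1 (hadj x hx) (ε / 3) (by positivity)
  refine ⟨N, fun n hn => ?_⟩
  have key : ∀ σ : RepSp A, dist (σ a) (σ x) ≤ dist a x := fun σ => by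
    rw [dist_eq_norm, dist_eq_norm, ← map_sub]
    exact σ.norm_apply_le _
  have h4 := dist_triangle4 (u n a) (u n x) (π x) (π a)
  have h1 := key (u n)
  have h2 := key π
  rw [dist_comm] at h2
  linarith [hN n hn]

end RepMetric

section Quotient

variable {A B : Type*} [CStarAlgebra A] [CStarAlgebra B] {α : A →⋆ₐ[ℂ] B}

theorem dRep_image {K : Set A} (hK : IsCompact K) (hK' : IsCompact (α '' K)) (π₁ π₂ : RepSp B) :
    dRep (α '' K) π₁ π₂ = dRep K (π₁.comp α) (π₂.comp α) := by
  refine le_antisymm (dRep_le (dRep_nonneg _ _ _) ?_) (dRep_le (dRep_nonneg _ _ _) ?_)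
  · rintro _ ⟨a, ha, rfl⟩
    exact norm_sub_le_dRep hK (π₁.comp α) (π₂.comp α) ha
  · exact fun a ha => norm_sub_le_dRep hK' π₁ π₂ (Set.mem_image_of_mem α ha)

theorem comp_mem_Sigma0 (hsurj : Function.Surjective α) {π : RepSp B} (hπ : π ∈ Sigma0 B) :
    π.comp α ∈ Sigma0 A := by
  rcases hπ with hirr | ⟨n, hn, ρ, hρ, u, hu⟩
  · exact .inl fun T hT => hirr T (hsurj.forall.2 hT)
  · exact .inr ⟨n, hn, ρ.comp α, fun T hT => hρ T (hsurj.forall.2 hT), u, fun a => hu (α a)⟩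

theorem Generates.image (hsurj : Function.Surjective α) (hα : Continuous α) {K : Set A}
    (hgen : Generates K) : Generates (α '' K) := by
  refine eq_top_iff.2 fun b _ => ?_
  obtain ⟨a, rfl⟩ := hsurj b
  have ha : a ∈ closure (StarAlgebra.adjoin ℂ K : Set A) := by
    rw [← StarSubalgebra.topologicalClosure_coe, hgen]
    trivial
  rw [← StarAlgHom.map_adjoin]
  exact map_mem_closure hα ha fun x hx => ⟨x, hx, rfl⟩

/-- A representation that vanishes on the kernel of a surjection factors through it. -/
theorem exists_comp_eq (hsurj : Function.Surjective α) (π : RepSp A)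
    (hker : ∀ a, α a = 0 → π a = 0) : ∃ σ : RepSp B, σ.comp α = π := by
  have heq : ∀ a a', α a = α a' → π a = π a' := fun a a' h => by
    rw [← sub_eq_zero, ← map_sub]
    exact hker _ (by rw [map_sub, h, sub_self])
  set s := Function.surjInv hsurj
  have hs : ∀ b, α (s b) = b := Function.surjInv_eq hsurj
  refine ⟨{ toFun := fun b => π (s b), map_one' := ?_, map_mul' := ?_, map_zero' := ?_,
            map_add' := ?_, commutes' := ?_, map_star' := ?_ }, ?_⟩
  · rw [← map_one π]
    exact heq _ _ (by rw [hs, map_one])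
  · intro x y
    rw [← map_mul]
    exact heq _ _ (by simp only [hs, map_mul])
  · exact hker _ (hs 0)
  · intro x y
    rw [← map_add]
    exact heq _ _ (by simp only [hs, map_add])
  · intro r
    rw [← AlgHomClass.commutes π r]
    exact heq _ _ (by rw [hs, AlgHomClass.commutes])
  · intro x
    rw [← map_star]
    exact heq _ _ (by simp only [hs, map_star])
  · ext1 a
    exact heq _ _ (hs (α a))

end Quotient

theorem stmt11 (A B : Type*) [CStarAlgebra A] [CStarAlgebra B]
    [TopologicalSpace.SeparableSpace A] [TopologicalSpace.SeparableSpace B]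
    (α : A →⋆ₐ[ℂ] B) (hsurj : Function.Surjective α)
    (K : Set A) (hK : IsCompact K) (hgen : Generates K)
    (hcomp : RepSeqCompact K (SigmaSet K)) :
    ∃ K' : Set B, IsCompact K' ∧ Generates K' ∧ RepSeqCompact K' (SigmaSet K') := by
  have hα : Continuous α :=
    AddMonoidHomClass.continuous_of_bound α 1 fun a => by
      simpa using NonUnitalStarAlgHom.norm_apply_le α a
  have hK' := hK.image hα
  refine ⟨α '' K, hK', hgen.image hsurj hα, fun u hu => ?_⟩
  obtain ⟨π, -, φ, hφ, hlim⟩ := hcomp (fun n => (u n).comp α) fun n ε hε => by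
    obtain ⟨σ, hσ, hd⟩ := hu n ε hε
    exact ⟨σ.comp α, comp_mem_Sigma0 hsurj hσ, by rwa [← dRep_image hK hK']⟩
  obtain ⟨σ, rfl⟩ := exists_comp_eq hsurj π fun a ha => by
    refine tendsto_nhds_unique (tendsto_apply_of_tendsto_dRep hK hgen hlim a) ?_
    simp [ha]
  simp only [← dRep_image hK hK'] at hlim
  refine ⟨σ, fun ε hε => ?_, φ, hφ, hlim⟩
  obtain ⟨n, hn⟩ := (hlim.eventually_lt_const (half_pos hε)).exists
  obtain ⟨τ, hτ, hd⟩ := hu (φ n) (ε / 2) (half_pos hε)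
  refine ⟨τ, hτ, ?_⟩
  have htri := dRep_triangle hK' σ (u (φ n)) τ
  rw [dRep_comm _ σ (u (φ n))] at htri
  linarith
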